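/- Let 0 < t < u with F(t) > 0 and let 𝔤 : (0,∞) × ℝ → ℝ be bounded measurable. Then ℙ-a.s., E[𝔤(τ, ξ_u) | σ(ξ_t)] = ∫_{(0,t]} (𝔤(r,0)/F(t)) ℙ_τ(dr) · 1_{{ξ_t = 0}} + ∫_{(t,u]} 𝔤(r,0) ϕ_{ξ^r_t}(ξ_t) ℙ_τ(dr) · 1_{{ξ_t ≠ 0}} + ∫_{(u,∞)} (∫_ℝ 𝔤(r,y) p(σ^r_{t,u}, y, μ^r_{t,u} ξ_t) dy) ϕ_{ξ^r_t}(ξ_t) ℙ_τ(dr) · 1_{{ξ_t ≠ 0}}. -/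

import Mathlib

open MeasureTheory ProbabilityTheory Real Set

/-- Independent variables can be integrated one after the other. -/
lemma integral_comp_of_indepFun {Ω S T : Type*} [MeasurableSpace Ω] {mS : MeasurableSpace S}
    {mT : MeasurableSpace T} {P : Measure Ω} [IsProbabilityMeasure P] {Y : Ω → S} {Z : Ω → T}
    (hY : Measurable Y) (hZ : Measurable Z) (hYZ : IndepFun Y Z P) {G : S → T → ℝ}
    (hG : Measurable (Function.uncurry G)) {C : ℝ} (hC : ∀ x y, |G x y| ≤ C) :
    ∫ ω, G (Y ω) (Z ω) ∂P = ∫ x, ∫ ω, G x (Z ω) ∂P ∂(P.map Y) := by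
  have : IsProbabilityMeasure (P.map Y) := Measure.isProbabilityMeasure_map hY.aemeasurable
  have : IsProbabilityMeasure (P.map Z) := Measure.isProbabilityMeasure_map hZ.aemeasurable
  have h := (indepFun_iff_map_prod_eq_prod_map_map hY.aemeasurable hZ.aemeasurable).1 hYZ
  have hint : Integrable (Function.uncurry G) ((P.map Y).prod (P.map Z)) :=
    Integrable.of_bound hG.aestronglyMeasurable C (ae_of_all _ fun z => hC z.1 z.2)
  calc ∫ ω, G (Y ω) (Z ω) ∂P
      = ∫ z, Function.uncurry G z ∂(P.map fun ω => (Y ω, Z ω)) :=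
        (integral_map (hY.prodMk hZ).aemeasurable hG.aestronglyMeasurable).symm
    _ = ∫ x, ∫ y, G x y ∂(P.map Z) ∂(P.map Y) := by
        rw [h, integral_prod _ hint]; rfl
    _ = _ := by
        refine integral_congr_ae (ae_of_all _ fun x => ?_)
        exact integral_map hZ.aemeasurable
          (hG.comp measurable_prodMk_left).aestronglyMeasurable

/-- A random variable independent of a σ-algebra can be integrated out last. -/
lemma integral_comp_of_indep {Ω S : Type*} {m mΩ : MeasurableSpace Ω} {mS : MeasurableSpace S}
    {P : Measure Ω} [IsProbabilityMeasure P] (hm : m ≤ mΩ) {Y : Ω → S} (hY : Measurable Y)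
    (hYm : Indep (MeasurableSpace.comap Y mS) m P) {G : S → Ω → ℝ}
    (hG : @Measurable (S × Ω) ℝ (mS.prod m) _ (Function.uncurry G)) {C : ℝ}
    (hC : ∀ x ω, |G x ω| ≤ C) :
    ∫ ω, G (Y ω) ω ∂P = ∫ x, ∫ ω, G x ω ∂P ∂(P.map Y) := by
  have hind : @IndepFun Ω S Ω mΩ mS m Y id P := by
    refine (@IndepFun_iff_Indep Ω S Ω mΩ mS m Y id P).2 ?_
    rwa [MeasurableSpace.comap_id]
  exact integral_comp_of_indepFun (mT := m) (Z := id) hY (measurable_id'' hm) hind hG hC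

/-- Gaussian regression: the law of `(Y, m * Y + W)` for independent centered Gaussian `Y`, `W`. -/
lemma integral_gaussian_regression {Ω : Type*} [MeasurableSpace Ω] {P : Measure Ω}
    [IsProbabilityMeasure P] {Y W : Ω → ℝ} (hY : Measurable Y) (hW : Measurable W)
    (hYW : IndepFun Y W P) {v s : NNReal} (hv : v ≠ 0) (hs : s ≠ 0)
    (hYlaw : P.map Y = gaussianReal 0 v) (hWlaw : P.map W = gaussianReal 0 s) (m : ℝ)
    {Ψ : ℝ → ℝ → ℝ} (hΨ : Measurable (Function.uncurry Ψ)) {C : ℝ} (hC : ∀ x y, |Ψ x y| ≤ C) :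
    ∫ ω, Ψ (Y ω) (m * Y ω + W ω) ∂P =
      ∫ x, gaussianPDFReal 0 v x * ∫ y, gaussianPDFReal (m * x) s y * Ψ x y := by
  have hG : Measurable (Function.uncurry fun x w : ℝ => Ψ x (m * x + w)) :=
    hΨ.comp (measurable_fst.prodMk (by fun_prop : Measurable fun z : ℝ × ℝ => m * z.1 + z.2))
  rw [integral_comp_of_indepFun hY hW hYW hG (fun x w => hC x _), hYlaw,
    integral_gaussianReal_eq_integral_smul hv]
  refine integral_congr_ae (ae_of_all _ fun x => ?_)
  have hx : Measurable (Ψ x) := hΨ.comp measurable_prodMk_left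
  have hmap : P.map (fun ω => m * x + W ω) = gaussianReal (m * x) s := by
    have := gaussianReal_map_const_add (μ := 0) (v := s) (m * x)
    rw [← hWlaw, Measure.map_map (by fun_prop) hW, zero_add] at this
    exact this
  have h := integral_gaussianReal_eq_integral_smul (μ := m * x) (f := Ψ x) hs
  rw [← hmap, integral_map (hW.const_add _).aemeasurable hx.aestronglyMeasurable] at h
  simp only [smul_eq_mul] at h ⊢
  rw [h]

lemma memLp_two_of_map_eq_gaussianReal {Ω : Type*} [MeasurableSpace Ω] {P : Measure Ω}
    {Y : Ω → ℝ} (hY : Measurable Y) {v : NNReal} (hv : P.map Y = gaussianReal 0 v) :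
    MemLp Y 2 P := by
  have := memLp_id_gaussianReal (μ := 0) (v := v) 2
  rw [← hv] at this
  exact (memLp_map_measure_iff (by fun_prop) hY.aemeasurable).1 this

lemma integral_eq_zero_of_map_eq_gaussianReal {Ω : Type*} [MeasurableSpace Ω] {P : Measure Ω}
    {Y : Ω → ℝ} (hY : Measurable Y) {v : NNReal} (hv : P.map Y = gaussianReal 0 v) :
    ∫ ω, Y ω ∂P = 0 := by
  have := integral_id_gaussianReal (μ := 0) (v := v)
  rwa [← hv, integral_map hY.aemeasurable (by fun_prop)] at this

/-- A centered Gaussian law is determined by the second moment. -/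
lemma map_eq_gaussianReal_integral_sq {Ω : Type*} [MeasurableSpace Ω] {P : Measure Ω}
    [IsProbabilityMeasure P] {Y : Ω → ℝ} (hY : Measurable Y) {v : NNReal}
    (hv : P.map Y = gaussianReal 0 v) :
    P.map Y = gaussianReal 0 (∫ ω, Y ω * Y ω ∂P).toNNReal := by
  have h2 := variance_id_gaussianReal (μ := 0) (v := v)
  rw [← hv, variance_map (by fun_prop) hY.aemeasurable, Function.id_comp,
    variance_of_integral_eq_zero (by fun_prop)
      (integral_eq_zero_of_map_eq_gaussianReal hY hv)] at h2
  have h3 : ∫ ω, Y ω * Y ω ∂P = v := by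
    rw [← h2]
    exact integral_congr_ae (ae_of_all _ fun ω => by simp [sq])
  rw [h3, Real.toNNReal_coe, hv]

/-- Uncorrelated, jointly centered Gaussian variables are independent. -/
lemma indepFun_of_forall_linearCombination_gaussian {Ω : Type*} [MeasurableSpace Ω]
    {P : Measure Ω} [IsProbabilityMeasure P] {Y W : Ω → ℝ} (hY : Measurable Y)
    (hW : Measurable W)
    (h : ∀ a b : ℝ, ∃ v : NNReal, P.map (fun ω => a * Y ω + b * W ω) = gaussianReal 0 v)
    (hYW : ∫ ω, Y ω * W ω ∂P = 0) : IndepFun Y W P := by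
  have hYv : ∃ v : NNReal, P.map Y = gaussianReal 0 v := by simpa using h 1 0
  have hWv : ∃ v : NNReal, P.map W = gaussianReal 0 v := by simpa using h 0 1
  obtain ⟨v, hv⟩ := hYv
  obtain ⟨w, hw⟩ := hWv
  have hlaw : HasGaussianLaw (fun ω => (Y ω, W ω)) P := by
    refine ⟨isGaussian_of_map_eq_gaussianReal fun L => ?_⟩
    obtain ⟨s, hs⟩ := h (L (1, 0)) (L (0, 1))
    refine ⟨0, s, ?_⟩
    rw [Measure.map_map (by fun_prop) (hY.prodMk hW), ← hs]
    congr 1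
    ext ω
    have : (Y ω, W ω) = Y ω • ((1, 0) : ℝ × ℝ) + W ω • ((0, 1) : ℝ × ℝ) := by simp
    simp only [Function.comp_apply]
    rw [this, map_add, map_smul, map_smul, smul_eq_mul, smul_eq_mul, mul_comm, mul_comm (W ω)]
  refine hlaw.indepFun_of_covariance_eq_zero ?_
  rw [covariance_eq_sub (memLp_two_of_map_eq_gaussianReal hY hv)
    (memLp_two_of_map_eq_gaussianReal hW hw), integral_eq_zero_of_map_eq_gaussianReal hY hv]
  simpa using hYW

lemma abs_mul_gaussianPDFReal_le (v : NNReal) (x : ℝ) :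
    |x| * gaussianPDFReal 0 v x ≤ 1 := by
  rcases eq_or_ne v 0 with rfl | hv
  · simp
  have hv' : (0 : ℝ) < v := by positivity
  set a := x ^ 2 / (2 * v) with ha
  have ha0 : 0 ≤ a := by positivity
  have h1 : √(2 * π * v) ^ 2 = 2 * π * v := Real.sq_sqrt (by positivity)
  have h2 : (0 : ℝ) < √(2 * π * v) := by positivity
  have hexp : -(x - 0) ^ 2 / (2 * (v : ℝ)) = -a := by rw [ha]; ring
  rw [gaussianPDFReal, hexp, Real.exp_neg, ← mul_inv, ← div_eq_mul_inv,
    div_le_one (by positivity)]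
  have h3 : 1 + a ≤ Real.exp a := by linarith [Real.add_one_le_exp a]
  have hx : x ^ 2 = 2 * v * a := by rw [ha]; field_simp
  refine (sq_le_sq₀ (abs_nonneg x) (by positivity)).1 ?_
  rw [sq_abs, mul_pow, h1, hx]
  have h4 : (1 + a) ^ 2 ≤ Real.exp a ^ 2 := pow_le_pow_left₀ (by positivity) h3 2
  have h5 : 2 * v * a ≤ 2 * π * v * (1 + a) ^ 2 := by
    have : a ≤ (1 + a) ^ 2 := by nlinarith
    have hpi : (1 : ℝ) ≤ π := by linarith [Real.pi_gt_three]
    nlinarith [mul_le_mul hpi this ha0 (by positivity)]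
  exact h5.trans (by gcongr)

lemma integral_gaussianPDFReal_le_one (m : ℝ) (v : NNReal) : ∫ x, gaussianPDFReal m v x ≤ 1 := by
  rcases eq_or_ne v 0 with rfl | hv
  · simp
  · exact (integral_gaussianPDFReal_eq_one m hv).le

lemma abs_integral_gaussianPDFReal_mul_le {m : ℝ} {v : NNReal} {h : ℝ → ℝ} {C : ℝ}
    (hC : ∀ x, |h x| ≤ C) : |∫ x, gaussianPDFReal m v x * h x| ≤ C := by
  have hC0 : 0 ≤ C := (abs_nonneg _).trans (hC 0)
  calc |∫ x, gaussianPDFReal m v x * h x| ≤ ∫ x, gaussianPDFReal m v x * C := by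
        rw [← Real.norm_eq_abs]
        refine norm_integral_le_of_norm_le ((integrable_gaussianPDFReal m v).mul_const C)
          (ae_of_all _ fun x => ?_)
        rw [Real.norm_eq_abs, abs_mul, abs_of_nonneg (gaussianPDFReal_nonneg m v x)]
        exact mul_le_mul_of_nonneg_left (hC x) (gaussianPDFReal_nonneg m v x)
    _ = (∫ x, gaussianPDFReal m v x) * C := integral_mul_const _ _
    _ ≤ 1 * C := mul_le_mul_of_nonneg_right (integral_gaussianPDFReal_le_one m v) hC0
    _ = C := one_mul C

section Mixture

variable {ν : Measure ℝ} {V : ℝ → NNReal}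

/-- The posterior mean of `K` under the Gaussian mixture with random variance is bounded by `K`. -/
lemma abs_posterior_le {K : ℝ → ℝ → ℝ} {C : ℝ}
    (hC : ∀ r x, |K r x| ≤ C) (x : ℝ) :
    |∫ r, K r x * (gaussianPDFReal 0 (V r) x / ∫ s, gaussianPDFReal 0 (V s) x ∂ν) ∂ν| ≤ C := by
  have hC0 : 0 ≤ C := (abs_nonneg _).trans (hC 0 0)
  set D := ∫ s, gaussianPDFReal 0 (V s) x ∂ν with hD
  rcases eq_or_ne D 0 with h0 | h0
  · simpa [h0] using hC0
  have hDpos : 0 < D := lt_of_le_of_ne (integral_nonneg fun r => gaussianPDFReal_nonneg _ _ _)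
    h0.symm
  have hint : Integrable (fun s => gaussianPDFReal 0 (V s) x) ν := not_imp_comm.1
    integral_undef h0
  calc |∫ r, K r x * (gaussianPDFReal 0 (V r) x / D) ∂ν|
      ≤ ∫ r, C * (gaussianPDFReal 0 (V r) x / D) ∂ν := by
        rw [← Real.norm_eq_abs]
        refine norm_integral_le_of_norm_le ((hint.div_const D).const_mul C)
          (ae_of_all _ fun r => ?_)
        have hq : 0 ≤ gaussianPDFReal 0 (V r) x / D :=
          div_nonneg (gaussianPDFReal_nonneg _ _ _) hDpos.le
        rw [Real.norm_eq_abs, abs_mul, abs_of_nonneg hq]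
        exact mul_le_mul_of_nonneg_right (hC r x) hq
    _ = C := by rw [integral_const_mul, integral_div, ← hD, div_self h0, mul_one]

variable [IsFiniteMeasure ν]

lemma integrable_gaussianPDFReal_var (hV : Measurable V) {x : ℝ} (hx : x ≠ 0) :
    Integrable (fun r => gaussianPDFReal 0 (V r) x) ν := by
  refine Integrable.of_bound
    (by unfold gaussianPDFReal; fun_prop : Measurable _).aestronglyMeasurable |x|⁻¹
    (ae_of_all _ fun r => ?_)
  rw [Real.norm_eq_abs, abs_of_nonneg (gaussianPDFReal_nonneg _ _ _), ← one_div,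
    le_div_iff₀ (abs_pos.2 hx), mul_comm]
  exact abs_mul_gaussianPDFReal_le _ _

lemma measurable_uncurry_gaussianPDFReal_var (hV : Measurable V) :
    Measurable (Function.uncurry fun r x => gaussianPDFReal 0 (V r) x) := by
  simp only [Function.uncurry_def, gaussianPDFReal]
  fun_prop

lemma integrable_prod_gaussianPDFReal_mul (hV : Measurable V) {k : ℝ → ℝ → ℝ}
    (hk : Measurable (Function.uncurry k)) {C : ℝ} (hC : ∀ r x, |k r x| ≤ C) :
    Integrable (Function.uncurry fun r x => gaussianPDFReal 0 (V r) x * k r x)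
      (ν.prod volume) := by
  have hq : Integrable (Function.uncurry fun r x => gaussianPDFReal 0 (V r) x)
      (ν.prod volume) := by
    have hm := measurable_uncurry_gaussianPDFReal_var hV
    refine (integrable_prod_iff hm.aestronglyMeasurable).2
      ⟨ae_of_all _ fun r => integrable_gaussianPDFReal 0 (V r), ?_⟩
    refine Integrable.of_bound hm.norm.stronglyMeasurable.integral_prod_right'.aestronglyMeasurable
      1 (ae_of_all _ fun r => ?_)
    simp only [Function.uncurry_apply_pair, Real.norm_eq_abs,
      abs_of_nonneg (gaussianPDFReal_nonneg _ _ _)]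
    rw [abs_of_nonneg (integral_nonneg fun x => gaussianPDFReal_nonneg _ _ _)]
    exact integral_gaussianPDFReal_le_one _ _
  exact hq.mul_bdd hk.aestronglyMeasurable (ae_of_all _ fun z => hC z.1 z.2)

lemma measurable_posterior (hV : Measurable V) {K : ℝ → ℝ → ℝ}
    (hK : Measurable (Function.uncurry K)) :
    Measurable fun x => ∫ r, K r x *
      (gaussianPDFReal 0 (V r) x / ∫ s, gaussianPDFReal 0 (V s) x ∂ν) ∂ν := by
  have hq := measurable_uncurry_gaussianPDFReal_var hV
  have hD : Measurable fun x => ∫ s, gaussianPDFReal 0 (V s) x ∂ν :=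
    hq.stronglyMeasurable.integral_prod_left.measurable
  refine (StronglyMeasurable.integral_prod_left (f := fun r x => K r x *
      (gaussianPDFReal 0 (V r) x / ∫ s, gaussianPDFReal 0 (V s) x ∂ν)) ?_).measurable
  exact (hK.mul (hq.div (hD.comp measurable_snd))).stronglyMeasurable

/-- Bayes' formula for a Gaussian mixture with random variance. -/
lemma integral_gaussianMixture_eq_posterior (hV : Measurable V) {K : ℝ → ℝ → ℝ}
    (hK : Measurable (Function.uncurry K)) {C : ℝ} (hC : ∀ r x, |K r x| ≤ C)
    {h : ℝ → ℝ} (hh : Measurable h) {c : ℝ} (hc : ∀ x, |h x| ≤ c) :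
    ∫ r, (∫ x, gaussianPDFReal 0 (V r) x * (h x * K r x)) ∂ν =
      ∫ r, (∫ x, gaussianPDFReal 0 (V r) x * (h x * ∫ r', K r' x *
        (gaussianPDFReal 0 (V r') x / ∫ s, gaussianPDFReal 0 (V s) x ∂ν) ∂ν)) ∂ν := by
  have hc0 : 0 ≤ c := (abs_nonneg _).trans (hc 0)
  have hh2 : Measurable fun z : ℝ × ℝ => h z.2 := hh.comp measurable_snd
  have hbd : ∀ {y a : ℝ}, |a| ≤ C → |h y * a| ≤ c * C := fun {y a} ha => by
    rw [abs_mul]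
    exact mul_le_mul (hc y) ha (abs_nonneg _) hc0
  rw [integral_integral_swap (integrable_prod_gaussianPDFReal_mul hV
      (k := fun r x => h x * K r x) (hh2.mul hK) fun r x => hbd (hC r x)),
    integral_integral_swap (integrable_prod_gaussianPDFReal_mul hV
      (k := fun _ x => h x * ∫ r', K r' x *
        (gaussianPDFReal 0 (V r') x / ∫ s, gaussianPDFReal 0 (V s) x ∂ν) ∂ν)
      (hh2.mul ((measurable_posterior hV hK).comp measurable_snd))
      fun r x => hbd (abs_posterior_le hC x))]
  refine integral_congr_ae ?_
  filter_upwards [compl_mem_ae_iff.2 (measure_singleton (μ := volume) (0 : ℝ))] with x hx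
  have hint := integrable_gaussianPDFReal_var (ν := ν) hV hx
  rw [integral_mul_const]
  set D := ∫ s, gaussianPDFReal 0 (V s) x ∂ν with hD
  rcases eq_or_ne D 0 with h0 | h0
  · have hz := (integral_eq_zero_iff_of_nonneg
      (fun r => gaussianPDFReal_nonneg _ _ _) hint).1 (hD ▸ h0)
    rw [h0, zero_mul]
    refine integral_eq_zero_of_ae ?_
    filter_upwards [hz] with r hr
    simp [hr]
  · rw [← mul_assoc, mul_comm D, mul_assoc, ← integral_const_mul, ← integral_const_mul]
    refine integral_congr_ae (ae_of_all _ fun r => ?_)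
    field_simp

end Mixture

/-- Evaluation of a process with continuous paths at `max r t` is jointly measurable. -/
lemma measurable_uncurry_eval_max {Ω : Type*} {m : MeasurableSpace Ω} {X : ℝ → Ω → ℝ}
    (hX : ∀ s, 0 ≤ s → Measurable (X s))
    (hXcont : ∀ ω, ContinuousOn (fun t => X t ω) (Set.Ici 0)) {t : ℝ} (ht : 0 ≤ t) :
    Measurable (Function.uncurry fun r ω => X (max r t) ω) := by
  refine measurable_uncurry_of_continuous_of_measurable (fun ω => ?_)
    fun r => hX _ (ht.trans (le_max_right r t))
  exact (hXcont ω).comp_continuous (by fun_prop) fun r => ht.trans (le_max_right r t)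

lemma integral_linearCombination_mul {Ω : Type*} [MeasurableSpace Ω] {P : Measure Ω}
    {X₁ X₂ X₃ : Ω → ℝ} (h₁ : MemLp X₁ 2 P) (h₂ : MemLp X₂ 2 P) (h₃ : MemLp X₃ 2 P)
    {R₁₁ R₁₂ R₁₃ R₂₂ R₂₃ R₃₃ : ℝ} (h₁₁ : ∫ ω, X₁ ω * X₁ ω ∂P = R₁₁)
    (h₁₂ : ∫ ω, X₁ ω * X₂ ω ∂P = R₁₂) (h₁₃ : ∫ ω, X₁ ω * X₃ ω ∂P = R₁₃)
    (h₂₂ : ∫ ω, X₂ ω * X₂ ω ∂P = R₂₂) (h₂₃ : ∫ ω, X₂ ω * X₃ ω ∂P = R₂₃)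
    (h₃₃ : ∫ ω, X₃ ω * X₃ ω ∂P = R₃₃) (a b c a' b' c' : ℝ) :
    ∫ ω, (a * X₁ ω + b * X₂ ω + c * X₃ ω) * (a' * X₁ ω + b' * X₂ ω + c' * X₃ ω) ∂P =
      a * a' * R₁₁ + b * b' * R₂₂ + c * c' * R₃₃ + (a * b' + a' * b) * R₁₂ +
        (a * c' + a' * c) * R₁₃ + (b * c' + b' * c) * R₂₃ := by
  have i₁₁ := (h₁.integrable_mul h₁).const_mul (a * a')
  have i₂₂ := (h₂.integrable_mul h₂).const_mul (b * b')
  have i₃₃ := (h₃.integrable_mul h₃).const_mul (c * c')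
  have i₁₂ := (h₁.integrable_mul h₂).const_mul (a * b' + a' * b)
  have i₁₃ := (h₁.integrable_mul h₃).const_mul (a * c' + a' * c)
  have i₂₃ := (h₂.integrable_mul h₃).const_mul (b * c' + b' * c)
  calc _ = ∫ ω, (a * a' * (X₁ * X₁) ω + b * b' * (X₂ * X₂) ω + c * c' * (X₃ * X₃) ω +
        (a * b' + a' * b) * (X₁ * X₂) ω + (a * c' + a' * c) * (X₁ * X₃) ω +
        (b * c' + b' * c) * (X₂ * X₃) ω) ∂P := by
        refine integral_congr_ae (ae_of_all _ fun ω => ?_)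
        simp only [Pi.mul_apply]
        ring
    _ = _ := by
        rw [integral_add (by exact (((i₁₁.add i₂₂).add i₃₃).add i₁₂).add i₁₃) i₂₃,
          integral_add (by exact ((i₁₁.add i₂₂).add i₃₃).add i₁₂) i₁₃,
          integral_add (by exact (i₁₁.add i₂₂).add i₃₃) i₁₂,
          integral_add (by exact i₁₁.add i₂₂) i₃₃, integral_add i₁₁ i₂₂]
        simp only [integral_const_mul, Pi.mul_apply, h₁₁, h₁₂, h₁₃, h₂₂, h₂₃, h₃₃]

/-- Law of a pair of values of a Gaussian bridge pinned by `X₃`, and of a single value. -/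
lemma gaussianBridge_law {Ω : Type*} [MeasurableSpace Ω] {P : Measure Ω}
    [IsProbabilityMeasure P] {X₁ X₂ X₃ : Ω → ℝ} (m₁ : Measurable X₁) (m₂ : Measurable X₂)
    (m₃ : Measurable X₃)
    (hG : ∀ a b c : ℝ, ∃ v : NNReal,
      P.map (fun ω => a * X₁ ω + b * X₂ ω + c * X₃ ω) = gaussianReal 0 v)
    {R₁₁ R₁₂ R₁₃ R₂₂ R₂₃ R₃₃ : ℝ} (h₁₁ : ∫ ω, X₁ ω * X₁ ω ∂P = R₁₁)
    (h₁₂ : ∫ ω, X₁ ω * X₂ ω ∂P = R₁₂) (h₁₃ : ∫ ω, X₁ ω * X₃ ω ∂P = R₁₃)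
    (h₂₂ : ∫ ω, X₂ ω * X₂ ω ∂P = R₂₂) (h₂₃ : ∫ ω, X₂ ω * X₃ ω ∂P = R₂₃)
    (h₃₃ : ∫ ω, X₃ ω * X₃ ω ∂P = R₃₃) (hpos : 0 < R₃₃) (hA : 0 < R₃₃ * R₁₁ - R₁₃ ^ 2) :
    P.map (fun ω => X₁ ω - R₁₃ / R₃₃ * X₃ ω) =
        gaussianReal 0 ((R₃₃ * R₁₁ - R₁₃ ^ 2) / R₃₃).toNNReal ∧
      (0 < (R₃₃ * R₂₂ - R₂₃ ^ 2) / R₃₃ -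
          (R₁₂ * R₃₃ - R₂₃ * R₁₃) ^ 2 / (R₃₃ * (R₃₃ * R₁₁ - R₁₃ ^ 2)) →
        ∀ (Ψ : ℝ → ℝ → ℝ), Measurable (Function.uncurry Ψ) → ∀ C : ℝ, (∀ x y, |Ψ x y| ≤ C) →
        ∫ ω, Ψ (X₁ ω - R₁₃ / R₃₃ * X₃ ω) (X₂ ω - R₂₃ / R₃₃ * X₃ ω) ∂P =
          ∫ x, gaussianPDFReal 0 ((R₃₃ * R₁₁ - R₁₃ ^ 2) / R₃₃).toNNReal x *
            ∫ y, gaussianPDFReal ((R₁₂ * R₃₃ - R₂₃ * R₁₃) / (R₃₃ * R₁₁ - R₁₃ ^ 2) * x)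
              ((R₃₃ * R₂₂ - R₂₃ ^ 2) / R₃₃ -
                (R₁₂ * R₃₃ - R₂₃ * R₁₃) ^ 2 / (R₃₃ * (R₃₃ * R₁₁ - R₁₃ ^ 2))).toNNReal y *
              Ψ x y) := by
  have l₁ : MemLp X₁ 2 P := by
    obtain ⟨v, hv⟩ := hG 1 0 0
    exact memLp_two_of_map_eq_gaussianReal m₁ (by simpa using hv)
  have l₂ : MemLp X₂ 2 P := by
    obtain ⟨v, hv⟩ := hG 0 1 0
    exact memLp_two_of_map_eq_gaussianReal m₂ (by simpa using hv)
  have l₃ : MemLp X₃ 2 P := by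
    obtain ⟨v, hv⟩ := hG 0 0 1
    exact memLp_two_of_map_eq_gaussianReal m₃ (by simpa using hv)
  have hE := integral_linearCombination_mul l₁ l₂ l₃ h₁₁ h₁₂ h₁₃ h₂₂ h₂₃ h₃₃
  set D := R₃₃ * R₁₁ - R₁₃ ^ 2 with hD
  set m := (R₁₂ * R₃₃ - R₂₃ * R₁₃) / D with hm
  set s := (R₃₃ * R₂₂ - R₂₃ ^ 2) / R₃₃ - (R₁₂ * R₃₃ - R₂₃ * R₁₃) ^ 2 / (R₃₃ * D) with hs
  set Y : Ω → ℝ := fun ω => X₁ ω - R₁₃ / R₃₃ * X₃ ω with hY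
  set W : Ω → ℝ := fun ω => (X₂ ω - R₂₃ / R₃₃ * X₃ ω) - m * Y ω with hW
  have hYm : Measurable Y := by fun_prop
  have hWm : Measurable W := by fun_prop
  have hY' : ∀ ω, Y ω = 1 * X₁ ω + 0 * X₂ ω + -(R₁₃ / R₃₃) * X₃ ω := fun ω => by
    simp only [hY]; ring
  have hW' : ∀ ω, W ω =
      -m * X₁ ω + 1 * X₂ ω + (m * (R₁₃ / R₃₃) - R₂₃ / R₃₃) * X₃ ω := fun ω => by
    simp only [hW, hY]; ring
  have hcomb : ∀ a b : ℝ, ∃ v : NNReal,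
      P.map (fun ω => a * Y ω + b * W ω) = gaussianReal 0 v := fun a b => by
    obtain ⟨v, hv⟩ := hG (a - b * m) b
      (-a * (R₁₃ / R₃₃) + b * (m * (R₁₃ / R₃₃) - R₂₃ / R₃₃))
    refine ⟨v, hv ▸ ?_⟩
    congr 1
    ext ω
    rw [hY', hW']
    ring
  have hYY : ∫ ω, Y ω * Y ω ∂P = D / R₃₃ := by
    simp only [hY']
    rw [hE, hD]
    field_simp
    ring
  have hYW : ∫ ω, Y ω * W ω ∂P = 0 := by
    simp only [hY', hW']
    rw [hE]
    have : m * D = R₁₂ * R₃₃ - R₂₃ * R₁₃ := by rw [hm]; field_simp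
    rw [hD] at this
    field_simp
    linear_combination -this
  have hWW : ∫ ω, W ω * W ω ∂P = s := by
    simp only [hW']
    rw [hE]
    have h1 : m * D = R₁₂ * R₃₃ - R₂₃ * R₁₃ := by rw [hm]; field_simp
    have h2 : s = (R₃₃ * R₂₂ - R₂₃ ^ 2) / R₃₃ - m * (R₁₂ * R₃₃ - R₂₃ * R₁₃) / R₃₃ := by
      rw [hs, hm]; field_simp
    rw [h2]
    rw [hD] at h1
    field_simp
    linear_combination m * h1
  have hYlaw : P.map Y = gaussianReal 0 (D / R₃₃).toNNReal := by
    obtain ⟨v, hv⟩ := hcomb 1 0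
    rw [← hYY]
    exact map_eq_gaussianReal_integral_sq hYm (v := v) (by simpa using hv)
  refine ⟨hYlaw, fun hspos Ψ hΨ C hC => ?_⟩
  have hWlaw : P.map W = gaussianReal 0 s.toNNReal := by
    obtain ⟨v, hv⟩ := hcomb 0 1
    rw [← hWW]
    exact map_eq_gaussianReal_integral_sq hWm (v := v) (by simpa using hv)
  rw [← integral_gaussian_regression hYm hWm
    (indepFun_of_forall_linearCombination_gaussian hYm hWm hcomb hYW)
    (Real.toNNReal_pos.2 (div_pos hA hpos)).ne' (Real.toNNReal_pos.2 hspos).ne'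
    hYlaw hWlaw m hΨ hC]
  refine integral_congr_ae (ae_of_all _ fun ω => ?_)
  simp only [hW, hY, add_sub_cancel]

/-- The bridge of length `r` of the process `X` with covariance function `R`. -/
noncomputable def gaussianBridge {Ω : Type*} (X : ℝ → Ω → ℝ) (R : ℝ → ℝ → ℝ) (r t : ℝ) (ω : Ω) :
    ℝ :=
  X t ω - R t (max r t) / R (max r t) (max r t) * X (max r t) ω

/-- The variance at time `t` of the bridge of length `r`. -/
noncomputable def bridgeVar (R : ℝ → ℝ → ℝ) (t r : ℝ) : ℝ :=
  (R r r * R t t - R t r ^ 2) / R r r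

/-- The regression coefficient of the bridge of length `r` at time `u` on its value at time `t`. -/
noncomputable def bridgeCoeff (R : ℝ → ℝ → ℝ) (t u r : ℝ) : ℝ :=
  (R t u * R r r - R u r * R t r) / (R r r * R t t - R t r ^ 2)

/-- The conditional variance of the bridge of length `r` at time `u` given its value at time `t`. -/
noncomputable def bridgeCondVar (R : ℝ → ℝ → ℝ) (t u r : ℝ) : ℝ :=
  (R r r * R u u - R u r ^ 2) / R r r -
    (R t u * R r r - R u r * R t r) ^ 2 / (R r r * (R r r * R t t - R t r ^ 2))

/-- The conditional mean of `Ψ r x` at time `u` for the bridge of length `r` that takes the value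
`x` at time `t`. -/
noncomputable def bridgeCondMean (R : ℝ → ℝ → ℝ) (t u : ℝ) (Ψ : ℝ → ℝ → ℝ → ℝ) (r x : ℝ) : ℝ :=
  if r ≤ u then Ψ r x 0 else
    ∫ y, gaussianPDFReal (bridgeCoeff R t u (max r t) * x)
      (bridgeCondVar R t u (max r t)).toNNReal y * Ψ r x y

section Bridge

variable {R : ℝ → ℝ → ℝ} {t u : ℝ} {Ψ : ℝ → ℝ → ℝ → ℝ} {C : ℝ}

lemma abs_bridgeCondMean_le (hC : ∀ r x y, |Ψ r x y| ≤ C) (r x : ℝ) :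
    |bridgeCondMean R t u Ψ r x| ≤ C := by
  unfold bridgeCondMean
  split_ifs
  · exact hC _ _ _
  · exact abs_integral_gaussianPDFReal_mul_le (hC r x)

lemma bridgeCondMean_const_mul (c : ℝ → ℝ) (r x : ℝ) :
    bridgeCondMean R t u (fun r x y => c x * Ψ r x y) r x = c x * bridgeCondMean R t u Ψ r x := by
  unfold bridgeCondMean
  split_ifs
  · rfl
  · rw [← integral_const_mul]
    refine integral_congr_ae (ae_of_all _ fun y => ?_)
    ring

lemma bridgeCondMean_one {r : ℝ} (h : u < r → 0 < bridgeCondVar R t u (max r t)) (x : ℝ) :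
    bridgeCondMean R t u (fun _ _ _ => 1) r x = 1 := by
  unfold bridgeCondMean
  split_ifs with hr
  · rfl
  · simp only [mul_one]
    exact integral_gaussianPDFReal_eq_one _ (Real.toNNReal_pos.2 (h (not_le.1 hr))).ne'

lemma measurable_bridgeVar (hR : ∀ s, Measurable fun r => R s (max r t))
    (hRd : Measurable fun r => R (max r t) (max r t)) :
    Measurable fun r => (bridgeVar R t (max r t)).toNNReal := by
  exact (((hRd.mul_const _).sub ((hR t).pow_const 2)).div hRd).real_toNNReal

lemma measurable_bridgeCondMean (hR : ∀ s, Measurable fun r => R s (max r t))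
    (hRd : Measurable fun r => R (max r t) (max r t))
    (hΨ : Measurable fun z : ℝ × ℝ × ℝ => Ψ z.1 z.2.1 z.2.2) :
    Measurable (Function.uncurry (bridgeCondMean R t u Ψ)) := by
  have ht := hR t
  have hu := hR u
  have hcoeff : Measurable fun r => bridgeCoeff R t u (max r t) :=
    ((hRd.const_mul _).sub (hu.mul ht)).div ((hRd.mul_const _).sub (ht.pow_const 2))
  have hvar : Measurable fun r => bridgeCondVar R t u (max r t) :=
    (((hRd.mul_const _).sub (hu.pow_const 2)).div hRd).sub
      ((((hRd.const_mul _).sub (hu.mul ht)).pow_const 2).div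
        (hRd.mul ((hRd.mul_const _).sub (ht.pow_const 2))))
  have h0 : Measurable fun z : ℝ × ℝ => Ψ z.1 z.2 0 :=
    hΨ.comp (measurable_fst.prodMk (measurable_snd.prodMk measurable_const))
  have h1 : Measurable fun z : (ℝ × ℝ) × ℝ => Ψ z.1.1 z.1.2 z.2 :=
    hΨ.comp (by fun_prop : Measurable fun z : (ℝ × ℝ) × ℝ => (z.1.1, z.1.2, z.2))
  refine Measurable.ite (measurableSet_le measurable_fst measurable_const) h0 ?_
  refine (StronglyMeasurable.integral_prod_right' (f := fun z : (ℝ × ℝ) × ℝ =>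
    gaussianPDFReal (bridgeCoeff R t u (max z.1.1 t) * z.1.2)
      (bridgeCondVar R t u (max z.1.1 t)).toNNReal z.2 * Ψ z.1.1 z.1.2 z.2) ?_).measurable
  refine Measurable.stronglyMeasurable (Measurable.mul ?_ h1)
  exact measurable_uncurry_gaussianPDFReal.comp
    (((hcoeff.comp measurable_fst.fst).mul measurable_fst.snd).prodMk
      ((hvar.comp measurable_fst.fst).real_toNNReal.prodMk measurable_snd))

lemma gaussianBridge_eq_zero {Ω : Type*} {X : ℝ → Ω → ℝ} {r : ℝ} (hRt : R t t ≠ 0) (hr : r ≤ t)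
    (ω : Ω) : gaussianBridge X R r t ω = 0 := by
  simp [gaussianBridge, max_eq_right hr, div_self hRt]

lemma measurable_uncurry_gaussianBridge {Ω : Type*} {m : MeasurableSpace Ω} {X : ℝ → Ω → ℝ}
    (hX : ∀ s, 0 ≤ s → Measurable (X s))
    (hXcont : ∀ ω, ContinuousOn (fun t => X t ω) (Set.Ici 0)) (ht : 0 ≤ t)
    (hR : ∀ s, Measurable fun r => R s (max r t))
    (hRd : Measurable fun r => R (max r t) (max r t)) :
    Measurable (Function.uncurry fun r ω => gaussianBridge X R r t ω) := by
  have h1 := measurable_uncurry_eval_max hX hXcont ht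
  have h2 : Measurable fun z : ℝ × Ω => X t z.2 := (hX t ht).comp measurable_snd
  have h3 : Measurable fun z : ℝ × Ω => R t (max z.1 t) := (hR t).comp measurable_fst
  have h4 : Measurable fun z : ℝ × Ω => R (max z.1 t) (max z.1 t) := hRd.comp measurable_fst
  exact h2.sub ((h3.div h4).mul h1)

lemma measurable_covariance_max {Ω : Type*} [MeasurableSpace Ω] {P : Measure Ω}
    [IsProbabilityMeasure P] {X : ℝ → Ω → ℝ} (hX : ∀ s, Measurable (X s))
    (hXcont : ∀ ω, ContinuousOn (fun t => X t ω) (Set.Ici 0))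
    (hR : ∀ s t, R s t = ∫ ω, X s ω * X t ω ∂P) (ht : 0 ≤ t) :
    (∀ s, Measurable fun r => R s (max r t)) ∧ Measurable fun r => R (max r t) (max r t) := by
  have h1 := measurable_uncurry_eval_max (fun s _ => hX s) hXcont ht
  simp only [hR]
  refine ⟨fun s => ?_, ?_⟩
  · exact (StronglyMeasurable.integral_prod_right' (f := fun z : ℝ × Ω =>
      X s z.2 * X (max z.1 t) z.2)
      (((hX s).comp measurable_snd).mul h1).stronglyMeasurable).measurable
  · exact (StronglyMeasurable.integral_prod_right' (f := fun z : ℝ × Ω =>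
      X (max z.1 t) z.2 * X (max z.1 t) z.2) (h1.mul h1).stronglyMeasurable).measurable

/-- Expectation of a function of two values of a Gaussian bridge longer than the first time. -/
lemma integral_gaussianBridge {Ω : Type*} [MeasurableSpace Ω] {P : Measure Ω}
    [IsProbabilityMeasure P] {X : ℝ → Ω → ℝ} (hX : ∀ s, Measurable (X s))
    (hGauss : ∀ (m : ℕ) (ts : Fin m → ℝ), (∀ i, 0 ≤ ts i) → ∀ c : Fin m → ℝ,
      ∃ v : NNReal, Measure.map (fun ω => ∑ i, c i * X (ts i) ω) P = gaussianReal 0 v)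
    (hR : ∀ s t, R s t = ∫ ω, X s ω * X t ω ∂P) (hRpos : ∀ t, 0 < t → 0 < R t t)
    (ht : 0 < t) (htu : t < u) {r : ℝ} (htr : t < r)
    (hA : 0 < R r r * R t t - R t r ^ 2) (hσ : u < r → 0 < bridgeCondVar R t u r)
    {Ψ : ℝ → ℝ → ℝ → ℝ} (hΨ : Measurable (Function.uncurry (Ψ r)))
    (hC : ∀ x y, |Ψ r x y| ≤ C) :
    ∫ ω, Ψ r (gaussianBridge X R r t ω) (gaussianBridge X R r u ω) ∂P =
      ∫ x, gaussianPDFReal 0 (bridgeVar R t r).toNNReal x * bridgeCondMean R t u Ψ r x := by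
  have hr : 0 < r := ht.trans htr
  have hu : 0 < u := ht.trans htu
  have hG : ∀ a b c : ℝ, ∃ v : NNReal,
      P.map (fun ω => a * X t ω + b * X u ω + c * X r ω) = gaussianReal 0 v := fun a b c => by
    obtain ⟨v, hv⟩ := hGauss 3 ![t, u, r] (fun i => by fin_cases i <;> simp <;> linarith)
      ![a, b, c]
    refine ⟨v, hv ▸ ?_⟩
    congr 1
    ext ω
    simp [Fin.sum_univ_three]
  obtain ⟨hlaw, hpair⟩ := gaussianBridge_law (hX t) (hX u) (hX r) hG (hR t t).symm (hR t u).symm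
    (hR t r).symm (hR u u).symm (hR u r).symm (hR r r).symm (hRpos r hr) hA
  have hv : (bridgeVar R t r).toNNReal ≠ 0 :=
    (Real.toNNReal_pos.2 (div_pos hA (hRpos r hr))).ne'
  have hbt : gaussianBridge X R r t = fun ω => X t ω - R t r / R r r * X r ω := by
    ext ω
    rw [gaussianBridge, max_eq_left htr.le]
  rcases le_or_gt r u with hru | hru
  · have h0 : Measurable fun x => Ψ r x 0 := hΨ.comp measurable_prodMk_right
    have hbm : Measurable (gaussianBridge X R r t) := by
      rw [hbt]
      have := hX t
      have := hX r
      fun_prop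
    simp only [gaussianBridge_eq_zero (hRpos u hu).ne' hru, bridgeCondMean, if_pos hru]
    rw [← integral_map (f := fun x => Ψ r x 0) hbm.aemeasurable h0.aestronglyMeasurable, hbt, hlaw]
    exact integral_gaussianReal_eq_integral_smul hv
  · have hbu : gaussianBridge X R r u = fun ω => X u ω - R u r / R r r * X r ω := by
      ext ω
      rw [gaussianBridge, max_eq_left hru.le]
    simp only [hbt, hbu, bridgeCondMean, if_neg (not_le.2 hru), max_eq_left htr.le]
    exact hpair (hσ hru) (Ψ r) hΨ C hC

/-- Joint law of an independent random length and of two values of the corresponding bridge. -/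
lemma integral_gaussianBridge_randomLength {Ω : Type*} [mΩ : MeasurableSpace Ω] {P : Measure Ω}
    [IsProbabilityMeasure P] {X : ℝ → Ω → ℝ} (hX : ∀ s, Measurable (X s))
    (hGauss : ∀ (m : ℕ) (ts : Fin m → ℝ), (∀ i, 0 ≤ ts i) → ∀ c : Fin m → ℝ,
      ∃ v : NNReal, Measure.map (fun ω => ∑ i, c i * X (ts i) ω) P = gaussianReal 0 v)
    (hXcont : ∀ ω, ContinuousOn (fun t => X t ω) (Set.Ici 0))
    (hR : ∀ s t, R s t = ∫ ω, X s ω * X t ω ∂P) (hRpos : ∀ t, 0 < t → 0 < R t t)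
    (hA : ∀ r, t < r → 0 < R r r * R t t - R t r ^ 2)
    (hσ : ∀ r, u < r → 0 < bridgeCondVar R t u r)
    {τ : Ω → ℝ} (hτ : Measurable τ)
    (hindep : Indep (MeasurableSpace.comap τ inferInstance)
      (⨆ t ∈ Set.Ici (0:ℝ), MeasurableSpace.comap (X t) inferInstance) P)
    (ht : 0 < t) (htu : t < u)
    (hΨ : Measurable fun z : ℝ × ℝ × ℝ => Ψ z.1 z.2.1 z.2.2)
    (hC : ∀ r x y, |Ψ r x y| ≤ C) :
    ∫ ω, Ψ (τ ω) (gaussianBridge X R (τ ω) t ω) (gaussianBridge X R (τ ω) u ω) ∂P =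
      (∫ r in Set.Iic t, Ψ r 0 0 ∂(P.map τ)) +
      ∫ r in Set.Ioi t, (∫ x, gaussianPDFReal 0 (bridgeVar R t (max r t)).toNNReal x *
        bridgeCondMean R t u Ψ r x) ∂(P.map τ) := by
  have hu : 0 < u := ht.trans htu
  have : IsProbabilityMeasure (P.map τ) := Measure.isProbabilityMeasure_map hτ.aemeasurable
  obtain ⟨hRt, hRdt⟩ := measurable_covariance_max hX hXcont hR ht.le
  obtain ⟨hRu, hRdu⟩ := measurable_covariance_max hX hXcont hR hu.le
  have hXm : ∀ s, 0 ≤ s → Measurable[⨆ t ∈ Set.Ici (0:ℝ),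
      MeasurableSpace.comap (X t) inferInstance] (X s) := fun s hs =>
    measurable_iff_comap_le.2
      (le_iSup₂_of_le (f := fun t (_ : t ∈ Set.Ici (0:ℝ)) =>
        MeasurableSpace.comap (X t) inferInstance) s hs le_rfl)
  have hG : ∀ m : MeasurableSpace Ω, (∀ s, 0 ≤ s → Measurable[m] (X s)) →
      Measurable (Function.uncurry fun r ω =>
        Ψ r (gaussianBridge X R r t ω) (gaussianBridge X R r u ω)) := fun m hm =>
    hΨ.comp (measurable_fst.prodMk
      ((measurable_uncurry_gaussianBridge hm hXcont ht.le hRt hRdt).prodMk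
        (measurable_uncurry_gaussianBridge hm hXcont hu.le hRu hRdu)))
  rw [integral_comp_of_indep (iSup₂_le fun s _ => (hX s).comap_le) hτ hindep
    (hG _ hXm) (fun r ω => hC r _ _)]
  have hint : Integrable (fun r => ∫ ω, Ψ r (gaussianBridge X R r t ω)
      (gaussianBridge X R r u ω) ∂P) (P.map τ) := by
    refine Integrable.of_bound
      (hG mΩ fun s _ => hX s).stronglyMeasurable.integral_prod_right.aestronglyMeasurable C
      (ae_of_all _ fun r => ?_)
    simpa using norm_integral_le_of_norm_le_const (μ := P) (C := C)
      (f := fun ω => Ψ r (gaussianBridge X R r t ω) (gaussianBridge X R r u ω))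
      (ae_of_all _ fun ω => hC r _ _)
  rw [← integral_add_compl measurableSet_Iic hint (s := Set.Iic t), Set.compl_Iic]
  congr 1
  · refine setIntegral_congr_fun measurableSet_Iic fun r hr => ?_
    have hr' : r ≤ t := hr
    simp [gaussianBridge_eq_zero (hRpos t ht).ne' hr',
      gaussianBridge_eq_zero (hRpos u hu).ne' (hr'.trans htu.le)]
  · refine setIntegral_congr_fun measurableSet_Ioi fun r hr => ?_
    have hr' : t < r := hr
    simp only [max_eq_left hr'.le]
    exact integral_gaussianBridge hX hGauss hR hRpos ht htu hr' (hA r hr') (hσ r)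
      (hΨ.comp (measurable_const.prodMk measurable_id)) (hC r)

end Bridge

/-- Conditional mean of `g r` at the second time given the value `x` at the first time, for a
Gaussian bridge of random length `r` with law `ν`. -/
noncomputable def bridgePosteriorMean (R : ℝ → ℝ → ℝ) (t u : ℝ) (ν : Measure ℝ) (g : ℝ → ℝ → ℝ)
    (x : ℝ) : ℝ :=
  if x = 0 then (∫ r in Set.Iic t, g r 0 ∂ν) / ν.real (Set.Iic t) else
    ∫ r in Set.Ioi t, bridgeCondMean R t u (fun r _ y => g r y) r x *
      (gaussianPDFReal 0 (bridgeVar R t (max r t)).toNNReal x /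
        ∫ s in Set.Ioi t, gaussianPDFReal 0 (bridgeVar R t (max s t)).toNNReal x ∂ν) ∂ν

lemma condExp_gaussianBridge_randomLength {Ω : Type*} [MeasurableSpace Ω] {P : Measure Ω}
    [IsProbabilityMeasure P] {X : ℝ → Ω → ℝ} {R : ℝ → ℝ → ℝ} {t u : ℝ}
    (hX : ∀ s, Measurable (X s))
    (hGauss : ∀ (m : ℕ) (ts : Fin m → ℝ), (∀ i, 0 ≤ ts i) → ∀ c : Fin m → ℝ,
      ∃ v : NNReal, Measure.map (fun ω => ∑ i, c i * X (ts i) ω) P = gaussianReal 0 v)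
    (hXcont : ∀ ω, ContinuousOn (fun t => X t ω) (Set.Ici 0))
    (hR : ∀ s t, R s t = ∫ ω, X s ω * X t ω ∂P) (hRpos : ∀ t, 0 < t → 0 < R t t)
    (hA : ∀ r, t < r → 0 < R r r * R t t - R t r ^ 2)
    (hσ : ∀ r, u < r → 0 < bridgeCondVar R t u r)
    {τ : Ω → ℝ} (hτ : Measurable τ)
    (hindep : Indep (MeasurableSpace.comap τ inferInstance)
      (⨆ t ∈ Set.Ici (0:ℝ), MeasurableSpace.comap (X t) inferInstance) P)
    (ht : 0 < t) (htu : t < u) (hFt : (P.map τ).real (Set.Iic t) ≠ 0)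
    {g : ℝ → ℝ → ℝ} (hg : Measurable (Function.uncurry g)) {C : ℝ} (hC : ∀ r x, |g r x| ≤ C) :
    P[(fun ω => g (τ ω) (gaussianBridge X R (τ ω) u ω)) |
        MeasurableSpace.comap (fun ω => gaussianBridge X R (τ ω) t ω) inferInstance] =ᵐ[P]
      fun ω => bridgePosteriorMean R t u (P.map τ) g (gaussianBridge X R (τ ω) t ω) := by
  have : IsProbabilityMeasure (P.map τ) := Measure.isProbabilityMeasure_map hτ.aemeasurable
  obtain ⟨hRt, hRdt⟩ := measurable_covariance_max hX hXcont hR ht.le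
  obtain ⟨hRu, hRdu⟩ := measurable_covariance_max hX hXcont hR (ht.trans htu).le
  have hτid : Measurable fun ω => (τ ω, ω) := hτ.prodMk measurable_id
  have hξt : Measurable fun ω => gaussianBridge X R (τ ω) t ω :=
    (measurable_uncurry_gaussianBridge (fun s _ => hX s) hXcont ht.le hRt hRdt).comp hτid
  have hξu : Measurable fun ω => gaussianBridge X R (τ ω) u ω :=
    (measurable_uncurry_gaussianBridge (fun s _ => hX s) hXcont (ht.trans htu).le hRu hRdu).comp
      hτid
  have hV := measurable_bridgeVar hRt hRdt
  have hK : Measurable (Function.uncurry (bridgeCondMean R t u fun r _ y => g r y)) :=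
    measurable_bridgeCondMean hRt hRdt
      (hg.comp (measurable_fst.prodMk measurable_snd.snd) :
        Measurable fun z : ℝ × ℝ × ℝ => g z.1 z.2.2)
  have hKC : ∀ r x, |bridgeCondMean R t u (fun r _ y => g r y) r x| ≤ C :=
    abs_bridgeCondMean_le fun r _ y => hC r y
  have hf : Measurable (bridgePosteriorMean R t u (P.map τ) g) :=
    Measurable.ite (measurableSet_singleton 0) measurable_const (measurable_posterior hV hK)
  set f := bridgePosteriorMean R t u (P.map τ) g with hfdef
  have hF0 : 0 < (P.map τ).real (Set.Iic t) := lt_of_le_of_ne measureReal_nonneg hFt.symm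
  have hfC : ∀ x, |f x| ≤ C := fun x => by
    rw [hfdef, bridgePosteriorMean]
    split_ifs
    · rw [abs_div, abs_of_pos hF0, div_le_iff₀ hF0, ← Real.norm_eq_abs]
      exact norm_setIntegral_le_of_norm_le_const (measure_lt_top _ _) fun r _ => hC r 0
    · exact abs_posterior_le hKC x
  have hgint : Integrable (fun ω => g (τ ω) (gaussianBridge X R (τ ω) u ω)) P :=
    Integrable.of_bound (hg.comp (hτ.prodMk hξu)).aestronglyMeasurable C
      (ae_of_all _ fun ω => hC _ _)
  refine (ae_eq_condExp_of_forall_setIntegral_eq hξt.comap_le hgint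
    (fun _ _ _ => ?_) ?_ ?_).symm
  · exact (Integrable.of_bound (hf.comp hξt).aestronglyMeasurable C
      (ae_of_all _ fun ω => hfC _)).integrableOn
  · rintro _ ⟨B, hB, rfl⟩ -
    set h : ℝ → ℝ := B.indicator 1 with hh
    have hhm : Measurable h := measurable_one.indicator hB
    have hh1 : ∀ x, |h x| ≤ 1 := fun x => by
      by_cases hx : x ∈ B <;> simp [hh, hx]
    have hset : ∀ k : Ω → ℝ, ∫ ω in (fun ω => gaussianBridge X R (τ ω) t ω) ⁻¹' B, k ω ∂P =
        ∫ ω, h (gaussianBridge X R (τ ω) t ω) * k ω ∂P := fun k => by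
      rw [← integral_indicator (hξt hB)]
      refine integral_congr_ae (ae_of_all _ fun ω => ?_)
      by_cases hx : gaussianBridge X R (τ ω) t ω ∈ B <;> simp [hh, hx]
    have hbd : ∀ {x a : ℝ}, |a| ≤ C → |h x * a| ≤ C := fun {x a} ha => by
      rw [abs_mul]
      exact (mul_le_of_le_one_left (abs_nonneg _) (hh1 x)).trans ha
    have hf2 : Measurable fun z : ℝ × ℝ × ℝ => h z.2.1 * f z.2.1 :=
      (hhm.mul hf).comp measurable_snd.fst
    have hg2 : Measurable fun z : ℝ × ℝ × ℝ => h z.2.1 * g z.1 z.2.2 :=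
      (hhm.comp measurable_snd.fst).mul (hg.comp (measurable_fst.prodMk measurable_snd.snd))
    rw [hset, hset]
    have e1 := integral_gaussianBridge_randomLength hX hGauss hXcont hR hRpos hA hσ hτ hindep ht
      htu (Ψ := fun _ x _ => h x * f x) hf2 (fun _ x _ => hbd (hfC x))
    have e2 := integral_gaussianBridge_randomLength hX hGauss hXcont hR hRpos hA hσ hτ hindep ht
      htu (Ψ := fun r x y => h x * g r y) hg2 (fun r x y => hbd (hC r y))
    rw [e1, e2]
    congr 1
    · simp only [integral_const_mul, setIntegral_const, smul_eq_mul]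
      rw [hfdef, bridgePosteriorMean, if_pos rfl]
      field_simp
    · simp only [bridgeCondMean_const_mul h]
      rw [integral_gaussianMixture_eq_posterior hV hK hKC hhm hh1]
      refine setIntegral_congr_fun measurableSet_Ioi fun r hr => ?_
      refine integral_congr_ae ?_
      filter_upwards [compl_mem_ae_iff.2 (measure_singleton (0 : ℝ))] with x hx
      have hx0 : x ≠ 0 := hx
      have hone := bridgeCondMean_const_mul (R := R) (t := t) (u := u) (Ψ := fun _ _ _ => 1)
        f r x
      simp only [mul_one] at hone
      rw [hone, bridgeCondMean_one, mul_one, hfdef, bridgePosteriorMean, if_neg hx0]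
      intro hur
      rw [max_eq_left (htu.trans hur).le]
      exact hσ r hur
  · exact (hf.comp (Measurable.of_comap_le le_rfl)).aestronglyMeasurable

lemma bridgePosteriorMean_of_ne_zero {R : ℝ → ℝ → ℝ} {t u : ℝ} {ν : Measure ℝ} [IsFiniteMeasure ν]
    (hRt : ∀ s, Measurable fun r => R s (max r t))
    (hRdt : Measurable fun r => R (max r t) (max r t)) (htu : t < u) {g : ℝ → ℝ → ℝ}
    (hg : Measurable (Function.uncurry g)) {C : ℝ} (hC : ∀ r x, |g r x| ≤ C) {x : ℝ} (hx : x ≠ 0) :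
    bridgePosteriorMean R t u ν g x =
      (∫ r in Set.Ioc t u, g r 0 * (gaussianPDFReal 0 (bridgeVar R t r).toNNReal x /
        ∫ s in Set.Ioi t, gaussianPDFReal 0 (bridgeVar R t s).toNNReal x ∂ν) ∂ν) +
      ∫ r in Set.Ioi u, (∫ y, g r y * gaussianPDFReal (bridgeCoeff R t u r * x)
          (bridgeCondVar R t u r).toNNReal y) * (gaussianPDFReal 0 (bridgeVar R t r).toNNReal x /
        ∫ s in Set.Ioi t, gaussianPDFReal 0 (bridgeVar R t s).toNNReal x ∂ν) ∂ν := by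
  have hK : Measurable (Function.uncurry (bridgeCondMean R t u fun r _ y => g r y)) :=
    measurable_bridgeCondMean hRt hRdt
      (hg.comp (measurable_fst.prodMk measurable_snd.snd) :
        Measurable fun z : ℝ × ℝ × ℝ => g z.1 z.2.2)
  have hD : ∫ s in Set.Ioi t, gaussianPDFReal 0 (bridgeVar R t (max s t)).toNNReal x ∂ν =
      ∫ s in Set.Ioi t, gaussianPDFReal 0 (bridgeVar R t s).toNNReal x ∂ν :=
    setIntegral_congr_fun measurableSet_Ioi fun s (hs : t < s) => by
      simp only [max_eq_left hs.le]
  rw [bridgePosteriorMean, if_neg hx, hD]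
  set D := ∫ s in Set.Ioi t, gaussianPDFReal 0 (bridgeVar R t s).toNNReal x ∂ν
  have hint : Integrable (fun r => bridgeCondMean R t u (fun r _ y => g r y) r x *
      (gaussianPDFReal 0 (bridgeVar R t (max r t)).toNNReal x / D)) ν :=
    ((integrable_gaussianPDFReal_var (measurable_bridgeVar hRt hRdt) hx).div_const D).bdd_mul
      (hK.comp measurable_prodMk_right).aestronglyMeasurable (c := C)
      (ae_of_all _ fun r => abs_bridgeCondMean_le (fun r _ y => hC r y) r x)
  rw [← Set.Ioc_union_Ioi_eq_Ioi htu.le, setIntegral_union (Set.Ioc_disjoint_Ioi le_rfl)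
    measurableSet_Ioi hint.integrableOn hint.integrableOn]
  congr 1
  · refine setIntegral_congr_fun measurableSet_Ioc fun r hr => ?_
    simp only [bridgeCondMean, if_pos hr.2, max_eq_left hr.1.le]
  · refine setIntegral_congr_fun measurableSet_Ioi fun r (hr : u < r) => ?_
    simp only [bridgeCondMean, if_neg (not_le.2 hr), max_eq_left (htu.trans hr).le, mul_comm]

/-- Joint Bayes formula for E[𝔤(τ, ξ_u) | σ(ξ_t)], 0 < t < u, F(t) > 0, 𝔤 bounded
measurable on (0,∞) × ℝ. -/
theorem stmt_6
    {Ω : Type*} [MeasurableSpace Ω] (P : Measure Ω) [IsProbabilityMeasure P]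
    (X : ℝ → Ω → ℝ)
    (hXmeas : ∀ t, Measurable (X t))
    (hGauss : ∀ (m : ℕ) (ts : Fin m → ℝ), (∀ i, 0 ≤ ts i) → ∀ c : Fin m → ℝ,
      ∃ v : NNReal, Measure.map (fun ω => ∑ i, c i * X (ts i) ω) P = gaussianReal 0 v)
    (hXcont : ∀ ω, ContinuousOn (fun t => X t ω) (Set.Ici 0))
    (hX0 : ∀ᵐ ω ∂P, X 0 ω = 0)
    (R : ℝ → ℝ → ℝ)
    (hR : ∀ s t, R s t = ∫ ω, X s ω * X t ω ∂P)
    (hRpos : ∀ t, 0 < t → 0 < R t t)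
    (hRnd : ∀ s t, 0 < s → 0 < t → s ≠ t → (R s t)^2 < R s s * R t t)
    (ξr : ℝ → ℝ → Ω → ℝ)
    (hξr : ∀ r t ω, ξr r t ω = X t ω - R t (max r t) / R (max r t) (max r t) * X (max r t) ω)
    (τ : Ω → ℝ) (hτmeas : Measurable τ) (hτpos : ∀ ω, 0 < τ ω)
    (hindep : Indep (MeasurableSpace.comap τ inferInstance)
      (⨆ t ∈ Set.Ici (0:ℝ), MeasurableSpace.comap (X t) inferInstance) P)
    (F : ℝ → ℝ) (hF : ∀ t, F t = (P {ω | τ ω ≤ t}).toReal)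
    (ξ : ℝ → Ω → ℝ) (hξ : ∀ t ω, ξ t ω = ξr (τ ω) t ω)
    (p : ℝ → ℝ → ℝ → ℝ)
    (hp : ∀ v x y, 0 < v →
      p v x y = (Real.sqrt (2 * Real.pi * v))⁻¹ * Real.exp (-(x - y)^2 / (2*v)))
    (A : ℝ → ℝ → ℝ) (hA : ∀ t s, A t s = R s s * R t t - R s t ^ 2)
    (φ : ℝ → ℝ → ℝ → ℝ) (hφ : ∀ t r x, 0 < t → t < r → φ t r x = p (A t r / R r r) x 0)
    (ϕ : ℝ → ℝ → ℝ → ℝ)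
    (hϕ : ∀ t r x, 0 < t → t < r →
      ϕ t r x = φ t r x / ∫ s in Set.Ioi t, φ t s x ∂(Measure.map τ P))
    (μB σB : ℝ → ℝ → ℝ → ℝ)
    (hμB : ∀ t u r, 0 < t → 0 < u → t < r → u < r →
      μB t u r = (R u t * R r r - R u r * R t r) / A t r)
    (hσB : ∀ t u r, 0 < t → 0 < u → t < r → u < r →
      σB t u r = A u r / R r r - (R u t * R r r - R u r * R t r)^2 / (R r r * A t r))
    (hnondeg : ∀ t u r, 0 < t → 0 < u → t < r → u < r → t ≠ u → 0 < σB t u r)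
    (t u : ℝ) (ht : 0 < t) (htu : t < u) (hFt : 0 < F t)
    (𝔤 : ℝ → ℝ → ℝ) (h𝔤meas : Measurable (Function.uncurry 𝔤))
    (C : ℝ) (h𝔤bdd : ∀ r x, |𝔤 r x| ≤ C) :
    P[(fun ω => 𝔤 (τ ω) (ξ u ω))|MeasurableSpace.comap (ξ t) inferInstance] =ᵐ[P]
      fun ω => (∫ r in Set.Ioc (0:ℝ) t, 𝔤 r 0 ∂(Measure.map τ P)) / F t *
          (if ξ t ω = 0 then 1 else 0)
        + (∫ r in Set.Ioc t u, 𝔤 r 0 * ϕ t r (ξ t ω) ∂(Measure.map τ P)) *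
          (if ξ t ω ≠ 0 then 1 else 0)
        + (∫ r in Set.Ioi u,
            (∫ y, 𝔤 r y * p (σB t u r) y (μB t u r * ξ t ω)) * ϕ t r (ξ t ω)
              ∂(Measure.map τ P)) *
          (if ξ t ω ≠ 0 then 1 else 0) := by
  have hRsymm : ∀ a b, R a b = R b a := fun a b => by simp only [hR, mul_comm]
  have hu : 0 < u := ht.trans htu
  have hApos : ∀ r, t < r → 0 < R r r * R t t - R t r ^ 2 := fun r hr => by
    have := hRnd t r ht (ht.trans hr) hr.ne
    linarith
  have hvar : ∀ r, A t r / R r r = bridgeVar R t r := fun r => by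
    rw [hA, bridgeVar, hRsymm r t]
  have hcoeff : ∀ r, u < r → μB t u r = bridgeCoeff R t u r := fun r hr => by
    rw [hμB t u r ht hu (htu.trans hr) hr, hA, bridgeCoeff, hRsymm r t, hRsymm u t]
  have hcondVar : ∀ r, u < r → σB t u r = bridgeCondVar R t u r := fun r hr => by
    rw [hσB t u r ht hu (htu.trans hr) hr, hA, hA, bridgeCondVar, hRsymm r t, hRsymm r u,
      hRsymm u t]
  have hσpos : ∀ r, u < r → 0 < bridgeCondVar R t u r := fun r hr =>
    hcondVar r hr ▸ hnondeg t u r ht hu (htu.trans hr) hr htu.ne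
  have hpdf : ∀ v x y, 0 < v → p v x y = gaussianPDFReal y v.toNNReal x := fun v x y hv => by
    rw [hp v x y hv, gaussianPDFReal, Real.coe_toNNReal v hv.le]
  have hφ' : ∀ r x, t < r → φ t r x = gaussianPDFReal 0 (bridgeVar R t r).toNNReal x :=
    fun r x hr => by
      rw [hφ t r x ht hr, hvar, hpdf]
      exact div_pos (hApos r hr) (hRpos r (ht.trans hr))
  have hϕ' : ∀ r x, t < r → ϕ t r x = gaussianPDFReal 0 (bridgeVar R t r).toNNReal x /
      ∫ s in Set.Ioi t, gaussianPDFReal 0 (bridgeVar R t s).toNNReal x ∂(Measure.map τ P) :=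
    fun r x hr => by
      rw [hϕ t r x ht hr, hφ' r x hr]
      congr 1
      exact setIntegral_congr_fun measurableSet_Ioi fun s hs => hφ' s x hs
  have : IsProbabilityMeasure (P.map τ) := Measure.isProbabilityMeasure_map hτmeas.aemeasurable
  have hFt' : (P.map τ).real (Set.Iic t) = F t := by
    rw [hF, measureReal_def, Measure.map_apply hτmeas measurableSet_Iic]
    rfl
  have hτ0 : (P.map τ).restrict (Set.Ioc 0 t) = (P.map τ).restrict (Set.Iic t) := by
    refine Measure.restrict_congr_set ?_
    have : ∀ᵐ r ∂(P.map τ), 0 < r :=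
      (ae_map_iff hτmeas.aemeasurable measurableSet_Ioi).2 (ae_of_all _ hτpos)
    filter_upwards [this] with r hr
    exact propext (and_iff_right hr)
  obtain ⟨hRt, hRdt⟩ := measurable_covariance_max hXmeas hXcont hR ht.le
  have hξb : ∀ s, ξ s = fun ω => gaussianBridge X R (τ ω) s ω := fun s => by
    ext ω
    rw [hξ, hξr, gaussianBridge, max_comm]
  have key := condExp_gaussianBridge_randomLength hXmeas hGauss hXcont hR hRpos hApos hσpos hτmeas
    hindep ht htu (hFt'.symm ▸ hFt.ne') h𝔤meas h𝔤bdd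
  rw [hξb u, hξb t]
  refine key.trans (ae_of_all _ fun ω => ?_)
  by_cases hx : gaussianBridge X R (τ ω) t ω = 0
  · simp [hx, bridgePosteriorMean, hτ0, hFt']
  · simp only [bridgePosteriorMean_of_ne_zero hRt hRdt htu h𝔤meas h𝔤bdd hx, hx, if_false, ne_eq,
      not_false_eq_true, if_true, mul_zero, zero_add, mul_one]
    congr 1
    · exact setIntegral_congr_fun measurableSet_Ioc fun r hr => by
        simp only [hϕ' r _ hr.1]
    · refine setIntegral_congr_fun measurableSet_Ioi fun r (hr : u < r) => ?_
      simp only [hϕ' r _ (htu.trans hr), hcoeff r hr, hcondVar r hr, hpdf _ _ _ (hσpos r hr)]
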